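/- arXiv:1407.5606 — 2 statements merged into one kernel-verified Lean document; each statement's English description precedes it below -/
import Mathlib

section
/- Fourier cutoff approximation, pointwise bound (Lemma 4.7, first bound): Let q∈W^{2,∞}(ℝ) be a symmetric cutoff function supported in [−1,1] with q(p)=1 for |p|≤1/2 and q'(p)≤0 for p>0. Let Q∈W^{2,∞}(ℝ²) be supported in [−L,L]², and for m∈ℕ define Q_m through its partial Fourier transform by Q̂_m(p,y) := Q̂(p,y)·q(p/m). Then there exists a constant C, depending only on L and q, such that for every m∈ℕ and every (x,y)∈ℝ²: |(Q_m−Q)(x,y)| ≤ C ‖Q‖_{W^{2,∞}} / ((1+x²) m). -/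
open MeasureTheory Filter
open scoped BigOperators

/-- The partial Fourier transform in the first variable:
`Q̂(p,y) = ∫ Q(x,y) e^{-ipx} dx`. -/
noncomputable def partialFT (Q : ℝ → ℝ → ℝ) : ℝ × ℝ → ℂ :=
  fun py => ∫ x : ℝ, Complex.exp (-(Complex.I * (py.1 : ℂ) * (x : ℂ))) * (Q x py.2 : ℂ)

/-- The `W^{2,∞}` Sobolev norm: sum of the sup norms of the iterated derivatives
of order at most `2`. -/
noncomputable def sobNormTwo {E' F' : Type*} [NormedAddCommGroup E'] [NormedSpace ℝ E']
    [NormedAddCommGroup F'] [NormedSpace ℝ F'] (f : E' → F') : ℝ :=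
  ∑ n ∈ Finset.range 3, ⨆ x, ‖iteratedFDeriv ℝ n f x‖

/-- The Fourier-cutoff regularization `Q_m`, defined through its partial Fourier transform
`Q̂_m(p,y) = Q̂(p,y) q(p/m)`, i.e. `Q_m(x,y) = (2π)⁻¹ ∫ Q̂(p,y) q(p/m) e^{ipx} dp`. -/
noncomputable def cutoffQ (Q : ℝ → ℝ → ℝ) (q : ℝ → ℝ) (m : ℕ) : ℝ × ℝ → ℂ :=
  fun xy => ((2 * Real.pi)⁻¹ : ℝ) •
    ∫ p : ℝ, partialFT Q (p, xy.2) * (q (p / m) : ℂ) *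
      Complex.exp (Complex.I * (p : ℂ) * (xy.1 : ℂ))

open scoped FourierTransform Real

/-- `f` is a `C²` function vanishing outside `[-L, L]` whose derivatives of order at most two are
bounded by `N`. -/
structure IsBump (L N : ℝ) (f : ℝ → ℂ) : Prop where
  contDiff : ContDiff ℝ 2 f
  eq_zero : ∀ x, L < |x| → f x = 0
  norm_le : ∀ k ≤ 2, ∀ x, ‖iteratedDeriv k f x‖ ≤ N

lemma norm_iteratedDeriv_mul_le_of_le {f g : ℝ → ℂ} (hf : ContDiff ℝ 2 f) (hg : ContDiff ℝ 2 g)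
    {x A B : ℝ} (hA : ∀ k ≤ 2, ‖iteratedDeriv k f x‖ ≤ A)
    (hB : ∀ k ≤ 2, ‖iteratedDeriv k g x‖ ≤ B) {k : ℕ} (hk : k ≤ 2) :
    ‖iteratedDeriv k (fun t => f t * g t) x‖ ≤ 4 * A * B := by
  have hA0 : 0 ≤ A := (norm_nonneg _).trans (hA 0 (by norm_num))
  have hB0 : 0 ≤ B := (norm_nonneg _).trans (hB 0 (by norm_num))
  rw [← norm_iteratedFDeriv_eq_norm_iteratedDeriv]
  calc _ ≤ ∑ i ∈ Finset.range (k + 1),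
      (k.choose i : ℝ) * ‖iteratedFDeriv ℝ i f x‖ * ‖iteratedFDeriv ℝ (k - i) g x‖ :=
        norm_iteratedFDeriv_mul_le hf hg x (by exact_mod_cast hk)
    _ ≤ ∑ i ∈ Finset.range (k + 1), (k.choose i : ℝ) * A * B := by
        refine Finset.sum_le_sum fun i hi => ?_
        rw [Finset.mem_range] at hi
        simp only [norm_iteratedFDeriv_eq_norm_iteratedDeriv]
        gcongr
        · exact hA i (by omega)
        · exact hB _ (by omega)
    _ = 2 ^ k * (A * B) := by
        simp_rw [mul_assoc]
        rw [← Finset.sum_mul]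
        congr 1
        exact_mod_cast Nat.sum_range_choose k
    _ ≤ 2 ^ 2 * (A * B) := by
        gcongr
        norm_num
    _ = 4 * A * B := by ring

lemma exists_norm_iteratedDeriv_le_of_isCompact {f : ℝ → ℂ} (hf : ContDiff ℝ 2 f) {s : Set ℝ}
    (hs : IsCompact s) : ∃ R > 0, ∀ k ≤ 2, ∀ x ∈ s, ‖iteratedDeriv k f x‖ ≤ R := by
  have hc : ContinuousOn (fun x => ∑ k ∈ Finset.range 3, ‖iteratedDeriv k f x‖) s := by
    refine (continuous_finsetSum _ fun k hk => ?_).continuousOn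
    rw [Finset.mem_range] at hk
    exact (hf.continuous_iteratedDeriv k (by exact_mod_cast (by omega : k ≤ 2))).norm
  obtain ⟨R, hR⟩ := hs.exists_bound_of_continuousOn hc
  refine ⟨max R 1, by positivity, fun k hk x hx => ?_⟩
  calc ‖iteratedDeriv k f x‖ ≤ ∑ k ∈ Finset.range 3, ‖iteratedDeriv k f x‖ :=
        Finset.single_le_sum (f := fun k => ‖iteratedDeriv k f x‖)
          (fun _ _ => norm_nonneg _) (Finset.mem_range.2 (by omega))
    _ ≤ R := (le_abs_self _).trans (hR x hx)
    _ ≤ _ := le_max_left _ _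

/-- A function which is locally constant outside a compact set has bounded derivatives. -/
lemma exists_norm_iteratedDeriv_le {f : ℝ → ℂ} (hf : ContDiff ℝ 2 f) {L : ℝ} {c : ℂ}
    (hc : ∀ x, L < |x| → f x = c) : ∃ R > 0, ∀ k ≤ 2, ∀ x, ‖iteratedDeriv k f x‖ ≤ R := by
  obtain ⟨R, hR0, hR⟩ :=
    exists_norm_iteratedDeriv_le_of_isCompact hf (isCompact_Icc (a := -L) (b := L))
  refine ⟨max R ‖c‖, lt_max_of_lt_left hR0, fun k hk x => ?_⟩
  by_cases hx : |x| ≤ L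
  · exact (hR k hk x (abs_le.1 hx)).trans (le_max_left _ _)
  · have h : f =ᶠ[nhds x] fun _ => c := by
      filter_upwards [(isOpen_lt continuous_const continuous_abs).mem_nhds (not_le.1 hx)] with t ht
      exact hc t ht
    rw [h.iteratedDeriv_eq, iteratedDeriv_const]
    split_ifs
    · exact le_max_right _ _
    · simp [hR0.le]

namespace IsBump

variable {L N : ℝ} {f : ℝ → ℂ}

lemma iteratedDeriv_eq_zero (hf : IsBump L N f) (k : ℕ) {x : ℝ} (hx : L < |x|) :
    iteratedDeriv k f x = 0 := by
  have h : f =ᶠ[nhds x] fun _ => 0 := by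
    filter_upwards [(isOpen_lt continuous_const continuous_abs).mem_nhds hx] with t ht
    exact hf.eq_zero t ht
  rw [h.iteratedDeriv_eq, iteratedDeriv_const, ite_self]

lemma hasCompactSupport_iteratedDeriv (hf : IsBump L N f) (k : ℕ) :
    HasCompactSupport (iteratedDeriv k f) := by
  refine HasCompactSupport.intro (isCompact_Icc (a := -L) (b := L)) fun x hx => ?_
  refine hf.iteratedDeriv_eq_zero k (not_le.1 fun h => hx (abs_le.1 h))

lemma integrable_iteratedDeriv (hf : IsBump L N f) {k : ℕ} (hk : k ≤ 2) :
    Integrable (iteratedDeriv k f) :=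
  (hf.contDiff.continuous_iteratedDeriv k (by exact_mod_cast hk)).integrable_of_hasCompactSupport
    (hf.hasCompactSupport_iteratedDeriv k)

lemma integrable (hf : IsBump L N f) : Integrable f := by
  simpa using hf.integrable_iteratedDeriv (k := 0) (by norm_num)

lemma nonneg (hf : IsBump L N f) : 0 ≤ N :=
  (norm_nonneg _).trans (hf.norm_le 0 (by norm_num) 0)

lemma integrable_pow_smul (hf : IsBump L N f) (k : ℕ) : Integrable fun x => x ^ k • f x := by
  refine Continuous.integrable_of_hasCompactSupport
    ((continuous_id.pow k).smul hf.contDiff.continuous)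
    (HasCompactSupport.intro (isCompact_Icc (a := -L) (b := L)) fun x hx => ?_)
  rw [hf.eq_zero x (not_le.1 fun h => hx (abs_le.1 h)), smul_zero]

lemma integral_norm_iteratedDeriv_le (hf : IsBump L N f) (hL : 0 < L) {k : ℕ} (hk : k ≤ 2) :
    ∫ x, ‖iteratedDeriv k f x‖ ≤ 2 * L * N := by
  have h : ∫ x, ‖iteratedDeriv k f x‖ = ∫ x in Set.Icc (-L) L, ‖iteratedDeriv k f x‖ := by
    refine (setIntegral_eq_integral_of_forall_compl_eq_zero fun x hx => ?_).symm
    rw [hf.iteratedDeriv_eq_zero k (not_le.1 fun h => hx (abs_le.1 h)), norm_zero]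
  rw [h]
  calc _ ≤ ∫ x in Set.Icc (-L) L, N :=
        integral_mono (hf.integrable_iteratedDeriv hk).norm.integrableOn (by simp)
          fun x => hf.norm_le k hk x
    _ = 2 * L * N := by
        rw [setIntegral_const, measureReal_def, Real.volume_Icc, ENNReal.toReal_ofReal (by linarith),
          smul_eq_mul]
        ring

lemma norm_fourier_le (hf : IsBump L N f) (hL : 0 < L) (w : ℝ) : ‖𝓕 f w‖ ≤ 2 * L * N := by
  have h := hf.integral_norm_iteratedDeriv_le hL (k := 0) (by norm_num)
  rw [iteratedDeriv_zero] at h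
  exact (VectorFourier.norm_fourierIntegral_le_integral_norm _ _ _ _ _).trans h

lemma sq_mul_norm_fourier_le (hf : IsBump L N f) (hL : 0 < L) (w : ℝ) :
    w ^ 2 * ‖𝓕 f w‖ ≤ 2 * L * N := by
  have h := congr_fun (Real.fourier_iteratedDeriv (N := 2) (n := 2) hf.contDiff
    (fun n hn => hf.integrable_iteratedDeriv (by exact_mod_cast hn)) le_rfl) w
  have h1 : ‖𝓕 (iteratedDeriv 2 f) w‖ ≤ 2 * L * N :=
    (VectorFourier.norm_fourierIntegral_le_integral_norm _ _ _ _ _).trans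
      (hf.integral_norm_iteratedDeriv_le hL le_rfl)
  rw [h, norm_smul] at h1
  refine le_trans ?_ h1
  gcongr
  simp only [norm_pow, norm_mul, Complex.norm_I, Complex.norm_real, Complex.norm_ofNat,
    Real.norm_eq_abs, mul_pow, sq_abs]
  rw [one_pow, mul_one]
  exact le_mul_of_one_le_left (sq_nonneg w) (by nlinarith [Real.pi_gt_three])

lemma integrable_fourier (hf : IsBump L N f) (hL : 0 < L) : Integrable (𝓕 f) := by
  refine (integrable_inv_one_add_sq.const_mul (4 * L * N)).mono'
    (Real.contDiff_fourier (N := 0) fun n hn => ?_).continuous.aestronglyMeasurable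
    (ae_of_all _ fun w => ?_)
  · obtain rfl : n = 0 := by simpa using hn
    simpa using hf.integrable.norm
  · rw [← div_eq_mul_inv, le_div_iff₀ (by positivity)]
    linarith [hf.norm_fourier_le hL w, hf.sq_mul_norm_fourier_le hL w]

lemma contDiff_fourier (hf : IsBump L N f) : ContDiff ℝ 2 (𝓕 f) := by
  refine Real.contDiff_fourier (N := 2) fun n _ => ?_
  simpa [norm_smul] using (hf.integrable_pow_smul n).norm

lemma mul_left (hf : IsBump L N f) {g : ℝ → ℂ} (hg : ContDiff ℝ 2 g) {G : ℝ}
    (hG : ∀ k ≤ 2, ∀ x ∈ Set.Icc (-L) L, ‖iteratedDeriv k g x‖ ≤ G) (hG0 : 0 ≤ G) :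
    IsBump L (4 * G * N) fun x => g x * f x where
  contDiff := hg.mul hf.contDiff
  eq_zero x hx := by rw [hf.eq_zero x hx, mul_zero]
  norm_le k hk x := by
    by_cases hx : |x| ≤ L
    · exact norm_iteratedDeriv_mul_le_of_le hg hf.contDiff (fun k hk => hG k hk x (abs_le.1 hx))
        (fun k hk => hf.norm_le k hk x) hk
    · have h : (fun x => g x * f x) =ᶠ[nhds x] fun _ => 0 := by
        filter_upwards [(isOpen_lt continuous_const continuous_abs).mem_nhds (not_le.1 hx)]
          with t ht
        rw [hf.eq_zero t ht, mul_zero]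
      rw [h.iteratedDeriv_eq, iteratedDeriv_const, ite_self, norm_zero]
      have := hf.nonneg
      positivity

end IsBump

/-- The Fourier transform of a `C²` bump, and its first two derivatives, decay quadratically. -/
lemma exists_sq_mul_norm_iteratedDeriv_fourier_le {L : ℝ} (hL : 0 < L) :
    ∃ A > 0, ∀ N f, IsBump L N f → ∀ k ≤ 2, ∀ w : ℝ,
      w ^ 2 * ‖iteratedDeriv k (𝓕 f) w‖ ≤ A * N := by
  have hg (k : ℕ) : ContDiff ℝ 2 fun x : ℝ => (-2 * π * Complex.I * x : ℂ) ^ k :=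
    (contDiff_const.mul Complex.ofRealCLM.contDiff).pow k
  choose G hG0 hG using fun k =>
    exists_norm_iteratedDeriv_le_of_isCompact (hg k) (isCompact_Icc (a := -L) (b := L))
  refine ⟨2 * L * (4 * (G 0 + G 1 + G 2)), ?_, fun N f hf k hk w => ?_⟩
  · have := hG0 0
    have := hG0 1
    have := hG0 2
    positivity
  · rw [Real.iteratedDeriv_fourier (N := 2) (fun n _ => hf.integrable_pow_smul n)
      (by exact_mod_cast hk)]
    refine ((hf.mul_left (hg k) (hG k) (hG0 k).le).sq_mul_norm_fourier_le hL w).trans ?_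
    have hGk : G k ≤ G 0 + G 1 + G 2 := by
      have := hG0 0
      have := hG0 1
      have := hG0 2
      interval_cases k <;> linarith
    have := hf.nonneg
    rw [mul_assoc (2 * L)]
    gcongr

/-- If `H` vanishes on `(-a, a)` and its derivatives of order at most two are `O(w⁻²)`, then its
inverse Fourier transform is `O(a⁻¹ (1 + x²)⁻¹)`. -/
lemma norm_fourierInv_le_of_sq_mul_le {H : ℝ → ℂ} (hH : ContDiff ℝ 2 H) {a B : ℝ} (ha : 0 < a)
    (hB : ∀ k ≤ 2, ∀ w : ℝ, w ^ 2 * ‖iteratedDeriv k H w‖ ≤ B)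
    (hz : ∀ w, |w| < a → H w = 0) (x : ℝ) :
    Integrable H ∧ (1 + x ^ 2) * ‖𝓕⁻ H x‖ ≤ 4 * π * B / a := by
  have hpt (k : ℕ) (hk : k ≤ 2) (w : ℝ) :
      ‖iteratedDeriv k H w‖ ≤ 2 * B / a ^ 2 * (1 + (w / a) ^ 2)⁻¹ := by
    have hB0 : 0 ≤ B := le_trans (by positivity) (hB 0 (by norm_num) 0)
    by_cases hw : |w| < a
    · have h : H =ᶠ[nhds w] fun _ => 0 := by
        filter_upwards [(isOpen_lt continuous_abs continuous_const).mem_nhds hw] with t ht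
        exact hz t ht
      rw [h.iteratedDeriv_eq, iteratedDeriv_const, ite_self, norm_zero]
      positivity
    · have haw : a ^ 2 ≤ w ^ 2 := by
        rw [← sq_abs w]
        exact pow_le_pow_left₀ ha.le (not_lt.1 hw) 2
      have h : 2 * B / a ^ 2 * (1 + (w / a) ^ 2)⁻¹ = 2 * B / (a ^ 2 + w ^ 2) := by
        field_simp
      rw [h, le_div_iff₀ (by positivity)]
      nlinarith [hB k hk w, norm_nonneg (iteratedDeriv k H w)]
  have hint : Integrable fun w : ℝ => 2 * B / a ^ 2 * (1 + (w / a) ^ 2)⁻¹ :=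
    (integrable_inv_one_add_sq.comp_div ha.ne').const_mul _
  have hI (k : ℕ) (hk : k ≤ 2) : Integrable (iteratedDeriv k H) :=
    hint.mono' (hH.continuous_iteratedDeriv k (by exact_mod_cast hk)).aestronglyMeasurable
      (ae_of_all _ (hpt k hk))
  have hle (k : ℕ) (hk : k ≤ 2) : ‖𝓕 (iteratedDeriv k H) (-x)‖ ≤ 2 * π * B / a := by
    refine (VectorFourier.norm_fourierIntegral_le_integral_norm _ _ _ _ _).trans ?_
    refine (integral_mono (hI k hk).norm hint (hpt k hk)).trans_eq ?_
    rw [integral_const_mul, Measure.integral_comp_div (fun w : ℝ => (1 + w ^ 2)⁻¹) a,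
      integral_univ_inv_one_add_sq, abs_of_pos ha, smul_eq_mul]
    field_simp
  refine ⟨by simpa using hI 0 (by norm_num), ?_⟩
  have h0 := hle 0 (by norm_num)
  have h2 := hle 2 le_rfl
  rw [Real.fourier_iteratedDeriv (N := 2) (n := 2) hH
    (fun n hn => hI n (by exact_mod_cast hn)) le_rfl, norm_smul] at h2
  rw [iteratedDeriv_zero] at h0
  simp only [norm_pow, norm_mul, Complex.norm_I, Complex.norm_real, Complex.norm_ofNat,
    Real.norm_eq_abs, mul_pow, sq_abs, neg_sq] at h2
  rw [Real.fourierInv_eq_fourier_neg]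
  have h3 : x ^ 2 * ‖𝓕 H (-x)‖ ≤ 2 ^ 2 * π ^ 2 * x ^ 2 * ‖𝓕 H (-x)‖ := by
    gcongr
    exact le_mul_of_one_le_left (sq_nonneg x) (by nlinarith [Real.pi_gt_three])
  have h4 : 4 * π * B / a = 2 * π * B / a + 2 * π * B / a := by ring
  linarith

lemma fourierInv_add_apply {f g : ℝ → ℂ} (hf : Integrable f) (hg : Integrable g) (x : ℝ) :
    𝓕⁻ (f + g) x = 𝓕⁻ f x + 𝓕⁻ g x := by
  simp only [Real.fourierInv_eq_fourier_neg]
  exact congr_fun (VectorFourier.fourierIntegral_add (L := innerₗ ℝ) Real.continuous_fourierChar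
    (by exact continuous_inner) hf hg) (-x)

lemma partialFT_eq_fourier (Q : ℝ → ℝ → ℝ) (p y : ℝ) :
    partialFT Q (p, y) = 𝓕 (fun x => (Q x y : ℂ)) (p / (2 * π)) := by
  rw [partialFT, Real.fourier_real_eq_integral_exp_smul]
  refine integral_congr_ae (ae_of_all _ fun x => ?_)
  simp only [smul_eq_mul]
  congr 2
  push_cast
  field_simp

lemma cutoffQ_eq_fourierInv (Q : ℝ → ℝ → ℝ) (q : ℝ → ℝ) (m : ℕ) (x y : ℝ) :
    cutoffQ Q q m (x, y) =
      𝓕⁻ (fun w => 𝓕 (fun t => (Q t y : ℂ)) w * (q (2 * π / m * w) : ℂ)) x := by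
  have h := Measure.integral_comp_div (fun w : ℝ => Complex.exp (↑(2 * π * (w * x)) * Complex.I) •
    (𝓕 (fun t => (Q t y : ℂ)) w * (q (2 * π / m * w) : ℂ))) (2 * π)
  rw [abs_of_pos (by positivity)] at h
  rw [Real.fourierInv_eq', cutoffQ]
  have hinner (w : ℝ) : inner ℝ w x = w * x := by simp [mul_comm]
  simp_rw [hinner]
  rw [eq_comm, ← inv_smul_eq_iff₀ (by positivity), inv_inv, ← h]
  refine integral_congr_ae (ae_of_all _ fun p => ?_)
  simp only [smul_eq_mul]
  have hp : 2 * π / m * (p / (2 * π)) = p / m := by field_simp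
  have he : ((2 * π * (p / (2 * π) * x) : ℝ) : ℂ) * Complex.I = Complex.I * p * x := by
    push_cast
    field_simp
  rw [partialFT_eq_fourier, hp, he, mul_comm]

/-- Slices of a compactly supported `C²` function on the plane are bumps, with the Sobolev norm as
uniform bound. -/
lemma isBump_slice {L : ℝ} {Q : ℝ → ℝ → ℝ} (hQ : ContDiff ℝ 2 (fun v : ℝ × ℝ => Q v.1 v.2))
    (hQs : Function.support (fun v : ℝ × ℝ => Q v.1 v.2) ⊆ Set.Icc (-L) L ×ˢ Set.Icc (-L) L)
    (y : ℝ) : IsBump L (sobNormTwo fun v : ℝ × ℝ => Q v.1 v.2) fun x => (Q x y : ℂ) where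
  contDiff := Complex.ofRealCLM.contDiff.comp
    (hQ.comp (contDiff_id.prodMk contDiff_const : ContDiff ℝ 2 fun x : ℝ => (x, y)))
  eq_zero x hx := by
    by_contra h
    have : (x, y) ∈ Function.support (fun v : ℝ × ℝ => Q v.1 v.2) := by simpa using h
    exact hx.not_ge (abs_le.2 (hQs this).1)
  norm_le k hk x := by
    have hcomp : HasCompactSupport (fun v : ℝ × ℝ => Q v.1 v.2) :=
      HasCompactSupport.of_support_subset_isCompact (isCompact_Icc.prod isCompact_Icc) hQs
    have hkc : (k : WithTop ℕ∞) ≤ 2 := by exact_mod_cast hk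
    have hshift : ContDiff ℝ 2 fun z : ℝ × ℝ => Q ((0, y) + z).1 ((0, y) + z).2 :=
      hQ.comp (contDiff_const.add contDiff_id : ContDiff ℝ 2 fun z : ℝ × ℝ => (0, y) + z)
    have hfun : (fun x => (Q x y : ℂ)) = Complex.ofRealLI ∘
        ((fun z : ℝ × ℝ => Q ((0, y) + z).1 ((0, y) + z).2) ∘
          ContinuousLinearMap.inl ℝ ℝ ℝ) := by
      ext t
      simp
    rw [← norm_iteratedFDeriv_eq_norm_iteratedDeriv, hfun,
      LinearIsometry.norm_iteratedFDeriv_comp_left _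
        (hshift.comp (ContinuousLinearMap.contDiff _)).contDiffAt hkc,
      ContinuousLinearMap.iteratedFDeriv_comp_right _ hshift x hkc,
      iteratedFDeriv_comp_add_left (f := fun v : ℝ × ℝ => Q v.1 v.2)]
    refine (ContinuousMultilinearMap.norm_compContinuousLinearMap_le _ _).trans ?_
    have hinl : ∏ _i : Fin k, ‖ContinuousLinearMap.inl ℝ ℝ ℝ‖ ≤ 1 :=
      Finset.prod_le_one (fun _ _ => norm_nonneg _)
        fun _ _ => ContinuousLinearMap.norm_inl_le_one ℝ ℝ ℝ
    refine (mul_le_of_le_one_right (norm_nonneg _) hinl).trans ?_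
    refine (le_ciSup (f := fun v => ‖iteratedFDeriv ℝ k (fun v : ℝ × ℝ => Q v.1 v.2) v‖)
      ?_ _).trans ?_
    · exact (hQ.continuous_iteratedFDeriv hkc).norm.bddAbove_range_of_hasCompactSupport
        (hcomp.iteratedFDeriv k).norm
    · exact Finset.single_le_sum
        (f := fun n => ⨆ v, ‖iteratedFDeriv ℝ n (fun v : ℝ × ℝ => Q v.1 v.2) v‖)
        (fun n _ => Real.iSup_nonneg fun _ => norm_nonneg _) (Finset.mem_range.2 (by omega))

/-- **Fourier cutoff approximation, pointwise bound** (Lemma 4.7, first bound).  For a fixed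
smooth cutoff `q` (supported in `[-1,1]`, symmetric, `≡ 1` on `[-1/2,1/2]`, nonincreasing on
the right half line) and any `L > 0`, there is `C = C(L,q) > 0` such that for every
`Q ∈ W^{2,∞}(ℝ²)` supported in `[-L,L]²` and every `m ≥ 1`,
`|(Q_m - Q)(x,y)| ≤ C ‖Q‖_{W^{2,∞}} / ((1+x²) m)` for all `(x,y)`. -/
theorem fourier_cutoff_pointwise
    (q : ℝ → ℝ) (hq : ContDiff ℝ 2 q)
    (hq_supp : Function.support q ⊆ Set.Icc (-1 : ℝ) 1)
    (hq_symm : ∀ p : ℝ, q (-p) = q p)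
    (hq_one : ∀ p : ℝ, |p| ≤ 1 / 2 → q p = 1)
    (hq_mono : ∀ p : ℝ, 0 < p → deriv q p ≤ 0)
    (L : ℝ) (hL : 0 < L) :
    ∃ C > (0 : ℝ), ∀ Q : ℝ → ℝ → ℝ,
      ContDiff ℝ 2 (fun v : ℝ × ℝ => Q v.1 v.2) →
      Function.support (fun v : ℝ × ℝ => Q v.1 v.2) ⊆
        Set.Icc (-L) L ×ˢ Set.Icc (-L) L →
      ∀ m : ℕ, 1 ≤ m → ∀ x y : ℝ,
        ‖cutoffQ Q q m (x, y) - (Q x y : ℂ)‖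
          ≤ C * sobNormTwo (fun v : ℝ × ℝ => Q v.1 v.2) / ((1 + x ^ 2) * m) := by
  have hχ : ContDiff ℝ 2 fun p => (q p : ℂ) - 1 :=
    (Complex.ofRealCLM.contDiff.comp hq).sub contDiff_const
  obtain ⟨R, hR0, hR⟩ := exists_norm_iteratedDeriv_le hχ (L := 1) (c := -1) fun p hp => by
    have : q p = 0 := by
      by_contra h
      exact hp.not_ge (abs_le.2 (hq_supp h))
    simp [this]
  obtain ⟨A, hA0, hA⟩ := exists_sq_mul_norm_iteratedDeriv_fourier_le hL
  refine ⟨4 * π * (4 * A * ((2 * π) ^ 2 * R)) * (4 * π), by positivity,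
    fun Q hQ hQs m hm x y => ?_⟩
  have hf := isBump_slice hQ hQs y
  set N := sobNormTwo fun v : ℝ × ℝ => Q v.1 v.2
  set f : ℝ → ℂ := fun t => (Q t y : ℂ)
  have hm0 : (0 : ℝ) < m := by exact_mod_cast hm
  have hm1 : (1 : ℝ) ≤ m := by exact_mod_cast hm
  have hr : ContDiff ℝ 2 fun w : ℝ => (q (2 * π / m * w) : ℂ) - 1 :=
    hχ.comp (contDiff_const.mul contDiff_id)
  have hrR : ∀ k ≤ 2, ∀ w, ‖iteratedDeriv k (fun w : ℝ => (q (2 * π / m * w) : ℂ) - 1) w‖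
      ≤ (2 * π) ^ 2 * R := by
    intro k hk w
    have h : iteratedDeriv k (fun w : ℝ => (q (2 * π / m * w) : ℂ) - 1) w =
        (2 * π / m) ^ k • iteratedDeriv k (fun p => (q p : ℂ) - 1) (2 * π / m * w) :=
      congr_fun (iteratedDeriv_comp_const_smul (n := k)
        (hχ.of_le (by exact_mod_cast hk)) (2 * π / m)) w
    rw [h, norm_smul, norm_pow, Real.norm_of_nonneg (by positivity)]
    have h1 : 2 * π / m ≤ 2 * π := div_le_self (by positivity) hm1
    have h2 : (2 * π / m) ^ k ≤ (2 * π) ^ 2 :=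
      (pow_le_pow_left₀ (by positivity) h1 k).trans
        (pow_le_pow_right₀ (by linarith [Real.pi_gt_three]) hk)
    exact mul_le_mul h2 (hR k hk _) (norm_nonneg _) (by positivity)
  obtain ⟨hHint, hH⟩ := norm_fourierInv_le_of_sq_mul_le (hf.contDiff_fourier.mul hr)
    (a := m / (4 * π)) (B := 4 * (A * N) * ((2 * π) ^ 2 * R)) (by positivity)
    (fun k hk w => by
      by_cases hw : w = 0
      · have := hf.nonneg
        rw [hw, zero_pow two_ne_zero, zero_mul]
        positivity
      · have hw2 : 0 < w ^ 2 := by positivity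
        have := norm_iteratedDeriv_mul_le_of_le hf.contDiff_fourier hr (x := w)
          (A := A * N / w ^ 2) (fun k hk => by
            rw [le_div_iff₀' hw2]
            exact hA N f hf k hk w) (fun k hk => hrR k hk w) hk
        calc _ ≤ w ^ 2 * (4 * (A * N / w ^ 2) * ((2 * π) ^ 2 * R)) := by gcongr
          _ = _ := by field_simp)
    (fun w hw => by
      rw [hq_one, Complex.ofReal_one, sub_self, mul_zero]
      rw [abs_mul, abs_of_pos (by positivity)]
      calc 2 * π / m * |w| ≤ 2 * π / m * (m / (4 * π)) := by gcongr
        _ = 1 / 2 := by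
          field_simp
          norm_num) x
  have hdiff : cutoffQ Q q m (x, y) - (Q x y : ℂ) =
      𝓕⁻ (fun w => 𝓕 f w * ((q (2 * π / m * w) : ℂ) - 1)) x := by
    have hinv : 𝓕⁻ (𝓕 f) x = f x := hf.integrable.fourierInv_fourier_eq
      (hf.integrable_fourier hL) hf.contDiff.continuous.continuousAt
    have hadd : (fun w => 𝓕 f w * (q (2 * π / m * w) : ℂ)) =
        (fun w => 𝓕 f w * ((q (2 * π / m * w) : ℂ) - 1)) + 𝓕 f := by
      ext w
      simp only [Pi.add_apply]
      ring
    rw [cutoffQ_eq_fourierInv, hadd, fourierInv_add_apply hHint (hf.integrable_fourier hL), hinv,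
      add_sub_cancel_right]
  rw [hdiff, le_div_iff₀ (by positivity)]
  calc _ = (1 + x ^ 2) * ‖𝓕⁻ (fun w => 𝓕 f w * ((q (2 * π / m * w) : ℂ) - 1)) x‖ * m := by ring
    _ ≤ 4 * π * (4 * (A * N) * ((2 * π) ^ 2 * R)) / (m / (4 * π)) * m := by gcongr
    _ = _ := by field_simp
end

section
/- Diagonalization of K by Chebyshev polynomials (equation (3.9) of the paper): For every integer n≥0 and every x∈(−2,2), the principal value integral lim_{ε→0+} ∫_{y∈(−2,2), |y−x|>ε} (P_n(x)−P_n(y))/(x−y)² · ρ(y) dy exists and equals (n/2)·P_n(x), where P_n(x)=U_n(x/2) and U_n is the Chebyshev polynomial of the second kind. -/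
open MeasureTheory

/-- The semicircle density. -/
noncomputable def semicircle (x : ℝ) : ℝ := Real.sqrt (max (4 - x ^ 2) 0) / (2 * Real.pi)

/-- The rescaled Chebyshev polynomials of the second kind, `P_n(x) = U_n(x/2)`. -/
noncomputable def chebP (n : ℕ) (x : ℝ) : ℝ :=
  (Polynomial.Chebyshev.U ℝ (n : ℤ)).eval (x / 2)

open Filter Set Polynomial.Chebyshev
open scoped Topology

lemma semicircle_eq (y : ℝ) : semicircle y = √(4 - y ^ 2) / (2 * Real.pi) := by
  rw [semicircle]
  congr 1
  rcases le_total 0 (4 - y ^ 2) with h | h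
  · rw [max_eq_left h]
  · rw [max_eq_right h, Real.sqrt_eq_zero_of_nonpos h, Real.sqrt_zero]

lemma continuous_semicircle : Continuous semicircle := by
  unfold semicircle
  fun_prop

/-- The interval `(-2, 2)` with the closed `ε`-neighbourhood of `x` removed. -/
def puncturedInterval (x ε : ℝ) : Set ℝ := {y | y ∈ Ioo (-2 : ℝ) 2 ∧ ε < |y - x|}

lemma measurableSet_puncturedInterval (x ε : ℝ) : MeasurableSet (puncturedInterval x ε) :=
  measurableSet_Ioo.inter
    (measurableSet_lt measurable_const (by fun_prop : Measurable fun y : ℝ => |y - x|))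

lemma integrableOn_puncturedInterval {x ε : ℝ} {f : ℝ → ℝ} (hε : 0 < ε)
    (hf : ContinuousOn f {x}ᶜ) : IntegrableOn f (puncturedInterval x ε) := by
  have hK : IsCompact (Icc (-2 : ℝ) 2 ∩ {y | ε ≤ |y - x|}) :=
    isCompact_Icc.inter_right (isClosed_le continuous_const (by fun_prop))
  refine ((hf.mono ?_).integrableOn_compact hK).mono_set ?_
  · rintro y ⟨-, hy⟩ rfl
    simp only [mem_ofPred_eq, sub_self, abs_zero] at hy
    exact hε.not_ge hy
  · exact fun y hy => ⟨Ioo_subset_Icc_self hy.1, hy.2.le⟩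

lemma tendsto_setIntegral_puncturedInterval (x : ℝ) {f : ℝ → ℝ}
    (hf : IntegrableOn f (Ioo (-2) 2)) :
    Tendsto (fun ε => ∫ y in puncturedInterval x ε, f y) (𝓝[>] 0)
      (𝓝 (∫ y in Ioo (-2 : ℝ) 2, f y)) := by
  have hm (ε : ℝ) : MeasurableSet {y : ℝ | ε < |y - x|} :=
    measurableSet_lt measurable_const (by fun_prop)
  have hcov : AECover (volume.restrict (Ioo (-2 : ℝ) 2)) (𝓝[>] 0)
      (fun ε : ℝ => {y : ℝ | ε < |y - x|}) := by
    refine ⟨?_, hm⟩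
    have hne : ∀ᵐ y ∂(volume.restrict (Ioo (-2 : ℝ) 2)), y ≠ x :=
      ae_restrict_of_ae (Measure.ae_ne volume x)
    filter_upwards [hne] with y hy
    exact mem_nhdsWithin_of_mem_nhds (Iio_mem_nhds (abs_pos.mpr (sub_ne_zero.mpr hy)))
  refine (hcov.integral_tendsto_of_countably_generated hf).congr fun ε => ?_
  rw [Measure.restrict_restrict (hm ε), inter_comm]
  rfl

lemma puncturedInterval_eq_union {x ε : ℝ} (hε : 0 < ε) (h₁ : -2 < x - ε) (h₂ : x + ε < 2) :
    puncturedInterval x ε = Ioo (-2) (x - ε) ∪ Ioo (x + ε) 2 := by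
  ext y
  simp only [puncturedInterval, mem_ofPred_eq, mem_union, mem_Ioo, lt_abs]
  constructor
  · rintro ⟨⟨h, h'⟩, h'' | h''⟩
    · exact Or.inr ⟨by linarith, h'⟩
    · exact Or.inl ⟨h, by linarith⟩
  · rintro (⟨h, h'⟩ | ⟨h, h'⟩)
    · exact ⟨⟨h, by linarith⟩, Or.inr (by linarith)⟩
    · exact ⟨⟨by linarith, h'⟩, Or.inl (by linarith)⟩

/-- The regular part of an antiderivative of `√(4 - y²) / (x - y)`. -/
noncomputable def hilbertRegularPart (x y : ℝ) : ℝ :=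
  x * Real.arcsin (y / 2) - √(4 - y ^ 2) +
    √(4 - x ^ 2) * Real.log (4 - x * y + √(4 - x ^ 2) * √(4 - y ^ 2))

lemma hilbertRegularPart_log_arg_pos {x y : ℝ} (hx : x ∈ Ioo (-2 : ℝ) 2)
    (hy : y ∈ Icc (-2 : ℝ) 2) : 0 < 4 - x * y + √(4 - x ^ 2) * √(4 - y ^ 2) := by
  have h : 0 < 4 - x * y := by
    obtain ⟨h₁, h₂⟩ := hx
    obtain ⟨h₃, h₄⟩ := hy
    nlinarith [sq_nonneg (x - y), sq_nonneg (x + y)]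
  positivity

lemma continuousOn_hilbertRegularPart {x : ℝ} (hx : x ∈ Ioo (-2 : ℝ) 2) :
    ContinuousOn (hilbertRegularPart x) (Icc (-2) 2) := by
  have hlog : ContinuousOn
      (fun y => Real.log (4 - x * y + √(4 - x ^ 2) * √(4 - y ^ 2))) (Icc (-2) 2) :=
    ContinuousOn.log (by fun_prop) fun y hy => (hilbertRegularPart_log_arg_pos hx hy).ne'
  have harc : Continuous fun y : ℝ => x * Real.arcsin (y / 2) - √(4 - y ^ 2) :=
    (continuous_const.mul (Real.continuous_arcsin.comp (by fun_prop))).sub (by fun_prop)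
  exact harc.continuousOn.add (continuousOn_const.mul hlog)

lemma hasDerivAt_hilbertRegularPart_sub_log {x y : ℝ} (hx : x ∈ Ioo (-2 : ℝ) 2)
    (hy : y ∈ Ioo (-2 : ℝ) 2) (hxy : y ≠ x) :
    HasDerivAt (fun z => hilbertRegularPart x z - √(4 - x ^ 2) * Real.log (x - z))
      (√(4 - y ^ 2) / (x - y)) y := by
  have hL := hilbertRegularPart_log_arg_pos hx (Ioo_subset_Icc_self hy)
  have hx4 : 0 < 4 - x ^ 2 := by nlinarith [hx.1, hx.2]
  have hy4 : 0 < 4 - y ^ 2 := by nlinarith [hy.1, hy.2]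
  have hxy' : x - y ≠ 0 := sub_ne_zero.mpr hxy.symm
  have hs2 := Real.sq_sqrt hx4.le
  have hr2 := Real.sq_sqrt hy4.le
  have hr0 := Real.sqrt_pos.mpr hy4
  have hroot : HasDerivAt (fun z : ℝ => √(4 - z ^ 2)) (-y / √(4 - y ^ 2)) y := by
    refine (((hasDerivAt_pow 2 y).const_sub 4).sqrt hy4.ne').congr_deriv ?_
    field_simp
    norm_num
  have harc : HasDerivAt (fun z : ℝ => Real.arcsin (z / 2)) (1 / √(4 - y ^ 2)) y := by
    have h₁ : y / 2 ≠ -1 := by have := hy.1; intro h; linarith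
    have h₂ : y / 2 ≠ 1 := by have := hy.2; intro h; linarith
    refine ((Real.hasDerivAt_arcsin h₁ h₂).comp y ((hasDerivAt_id y).div_const 2)).congr_deriv ?_
    rw [show 4 - y ^ 2 = 2 ^ 2 * (1 - (y / 2) ^ 2) by ring, Real.sqrt_mul (by norm_num),
      Real.sqrt_sq (by norm_num)]
    ring
  have hlin : HasDerivAt (fun z : ℝ => 4 - x * z) (-x) y := by
    simpa using ((hasDerivAt_id y).const_mul x).const_sub 4
  have hlog := (hlin.add (hroot.const_mul √(4 - x ^ 2))).log hL.ne'
  have hlog' : HasDerivAt (fun z : ℝ => Real.log (x - z)) (-1 / (x - y)) y :=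
    ((hasDerivAt_id y).const_sub x).log hxy'
  refine ((((harc.const_mul x).sub hroot).add (hlog.const_mul √(4 - x ^ 2))).sub
    (hlog'.const_mul √(4 - x ^ 2))).congr_deriv ?_
  simp only [Pi.add_apply]
  set s := √(4 - x ^ 2)
  set r := √(4 - y ^ 2)
  have key : (-x + s * (-y / r)) / (4 - x * y + s * r) = s / ((x - y) * r) - 1 / (x - y) := by
    field_simp
    linear_combination (-r) * hs2 + s * hr2
  rw [key]
  field_simp
  linear_combination hs2 - hr2

lemma integral_sqrt_div_sub_eq {x a b : ℝ} (hx : x ∈ Ioo (-2 : ℝ) 2) (ha : -2 ≤ a) (hb : b ≤ 2)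
    (hab : a ≤ b) (hxab : x ∉ Icc a b) :
    ∫ y in Ioo a b, √(4 - y ^ 2) / (x - y) =
      (hilbertRegularPart x b - √(4 - x ^ 2) * Real.log (x - b)) -
        (hilbertRegularPart x a - √(4 - x ^ 2) * Real.log (x - a)) := by
  have hne : ∀ y ∈ Icc a b, x - y ≠ 0 := fun y hy h => hxab (by rwa [sub_eq_zero.mp h])
  rw [← integral_Ioc_eq_integral_Ioo, ← intervalIntegral.integral_of_le hab]
  refine intervalIntegral.integral_eq_sub_of_hasDerivAt_of_le hab
    (f := fun z => hilbertRegularPart x z - √(4 - x ^ 2) * Real.log (x - z)) ?_ ?_ ?_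
  · refine ((continuousOn_hilbertRegularPart hx).mono (Icc_subset_Icc ha hb)).sub
      (continuousOn_const.mul (ContinuousOn.log (by fun_prop) hne))
  · intro y hy
    refine hasDerivAt_hilbertRegularPart_sub_log hx (Ioo_subset_Ioo ha hb hy) ?_
    rintro rfl
    exact hxab (Ioo_subset_Icc_self hy)
  · refine ContinuousOn.intervalIntegrable_of_Icc hab ?_
    exact ContinuousOn.div (by fun_prop) (by fun_prop) hne

lemma tendsto_hilbert_semicircle {x : ℝ} (hx : x ∈ Ioo (-2 : ℝ) 2) :
    Tendsto (fun ε => ∫ y in puncturedInterval x ε, semicircle y / (x - y)) (𝓝[>] 0)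
      (𝓝 (x / 2)) := by
  have hx₁ := hx.1
  have hx₂ := hx.2
  set R := hilbertRegularPart x
  have hR : ContinuousAt R x :=
    (continuousOn_hilbertRegularPart hx).continuousAt (Icc_mem_nhds hx₁ hx₂)
  have hends : (R 2 - √(4 - x ^ 2) * Real.log (x - 2)) -
      (R (-2) - √(4 - x ^ 2) * Real.log (x - -2)) = Real.pi * x := by
    have h₁ : Real.log (4 - x * 2) = Real.log 2 + Real.log (x - 2) := by
      rw [← Real.log_neg_eq_log (x - 2), ← Real.log_mul (by norm_num) (by linarith)]
      ring_nf
    have h₂ : Real.log (4 - x * -2) = Real.log 2 + Real.log (x - -2) := by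
      rw [← Real.log_mul (by norm_num) (by linarith)]
      ring_nf
    have h₃ : √(4 - (2 : ℝ) ^ 2) = 0 := by norm_num
    have h₄ : √(4 - (-2 : ℝ) ^ 2) = 0 := by norm_num
    have h₅ : Real.arcsin ((2 : ℝ) / 2) = Real.pi / 2 := by simp
    have h₆ : Real.arcsin ((-2 : ℝ) / 2) = -(Real.pi / 2) := by
      rw [show (-2 : ℝ) / 2 = -1 by norm_num, Real.arcsin_neg_one]
    simp only [R, hilbertRegularPart, h₃, h₄, h₅, h₆, mul_zero, add_zero, h₁, h₂]
    ring
  have hlim : Tendsto (fun ε : ℝ => (R (x - ε) - R (x + ε) + Real.pi * x) / (2 * Real.pi))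
      (𝓝[>] 0) (𝓝 (x / 2)) := by
    have hm : Tendsto (fun ε : ℝ => R (x - ε)) (𝓝 0) (𝓝 (R x)) :=
      hR.tendsto.comp (Continuous.tendsto' (by fun_prop) 0 x (by simp))
    have hp : Tendsto (fun ε : ℝ => R (x + ε)) (𝓝 0) (𝓝 (R x)) :=
      hR.tendsto.comp (Continuous.tendsto' (by fun_prop) 0 x (by simp))
    have h := (((hm.sub hp).add_const (Real.pi * x)).div_const (2 * Real.pi)).mono_left
      (nhdsWithin_le_nhds (s := Ioi 0))
    convert h using 2
    have := Real.pi_ne_zero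
    field_simp
    ring
  refine hlim.congr' ?_
  have hsmall : ∀ᶠ ε : ℝ in 𝓝[>] 0, ε < min (x + 2) (2 - x) :=
    mem_nhdsWithin_of_mem_nhds (Iio_mem_nhds (lt_min (by linarith) (by linarith)))
  filter_upwards [hsmall, self_mem_nhdsWithin] with ε hε hε0
  obtain ⟨h₁, h₂⟩ := lt_min_iff.mp hε
  rw [mem_Ioi] at hε0
  have hcont : ContinuousOn (fun y => √(4 - y ^ 2) / (x - y)) {x}ᶜ :=
    ContinuousOn.div (by fun_prop) (by fun_prop) fun y hy h => hy (sub_eq_zero.mp h).symm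
  have hint := integrableOn_puncturedInterval hε0 hcont
  have hset := puncturedInterval_eq_union (x := x) hε0 (by linarith) (by linarith)
  have hdisj : Disjoint (Ioo (-2 : ℝ) (x - ε)) (Ioo (x + ε) 2) :=
    Set.disjoint_left.mpr fun y hy hy' => by linarith [hy.2, hy'.1]
  have hval : ∫ y in puncturedInterval x ε, √(4 - y ^ 2) / (x - y) =
      R (x - ε) - R (x + ε) + Real.pi * x := by
    rw [hset] at hint ⊢
    rw [setIntegral_union hdisj measurableSet_Ioo hint.left_of_union hint.right_of_union,
      integral_sqrt_div_sub_eq hx le_rfl (by linarith) (by linarith)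
        (fun h => by linarith [h.2]),
      integral_sqrt_div_sub_eq hx (by linarith) le_rfl (by linarith)
        (fun h => by linarith [h.1]), ← hends,
      show x - (x - ε) = ε by ring, show x - (x + ε) = -ε by ring, Real.log_neg_eq_log]
    ring
  simp_rw [semicircle_eq, div_right_comm _ (2 * Real.pi)]
  rw [integral_div, hval]

lemma one_sub_sq_mul_eval_U (k : ℤ) (t : ℝ) :
    (1 - t ^ 2) * (U ℝ k).eval t = ((T ℝ k).eval t - (T ℝ (k + 2)).eval t) / 2 := by
  have h₁ := congrArg (Polynomial.eval t) (one_sub_X_sq_mul_U_eq_pol_in_T ℝ k)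
  have h₂ := congrArg (Polynomial.eval t) (T_add_two ℝ k)
  simp only [Polynomial.eval_sub, Polynomial.eval_mul, Polynomial.eval_pow, Polynomial.eval_X,
    Polynomial.eval_one, Polynomial.eval_ofNat] at h₁ h₂
  linarith

lemma integral_eval_U_mul_semicircle (k : ℤ) (hk : 0 ≤ k) :
    ∫ y in Ioo (-2 : ℝ) 2, (U ℝ k).eval (y / 2) * semicircle y = if k = 0 then 1 else 0 := by
  have hscale : ∫ y in (-2 : ℝ)..2, (U ℝ k).eval (y / 2) * semicircle y =
      2 / Real.pi * ∫ t in (-1 : ℝ)..1, (U ℝ k).eval t * √(1 - t ^ 2) := by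
    have h := intervalIntegral.integral_comp_div (a := -2) (b := 2)
      (fun t => (U ℝ k).eval t * √(1 - t ^ 2) / Real.pi) (two_ne_zero (α := ℝ))
    rw [neg_div, div_self two_ne_zero, intervalIntegral.integral_div Real.pi
      (fun t => (U ℝ k).eval t * √(1 - t ^ 2)), smul_eq_mul] at h
    rw [div_mul_eq_mul_div, mul_div_assoc, ← h]
    refine intervalIntegral.integral_congr fun y _ => ?_
    simp only [semicircle_eq]
    rw [show 4 - y ^ 2 = 2 ^ 2 * (1 - (y / 2) ^ 2) by ring, Real.sqrt_mul (by norm_num),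
      Real.sqrt_sq (by norm_num)]
    field_simp
  have hT : ∫ t in (-1 : ℝ)..1, (U ℝ k).eval t * √(1 - t ^ 2) =
      ∫ t, ((T ℝ k).eval t - (T ℝ (k + 2)).eval t) / 2 ∂measureT := by
    rw [integral_measureT]
    refine intervalIntegral.integral_congr fun t _ => ?_
    simp only [← one_sub_sq_mul_eval_U]
    rcases eq_or_ne (√(1 - t ^ 2)) 0 with h | h
    · simp [h]
    · have h0 : 0 ≤ 1 - t ^ 2 := by
        by_contra hneg
        exact h (Real.sqrt_eq_zero_of_nonpos (not_le.mp hneg).le)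
      rw [Real.sqrt_inv]
      field_simp
      rw [Real.sq_sqrt h0]
  rw [← integral_Ioc_eq_integral_Ioo, ← intervalIntegral.integral_of_le (by norm_num), hscale, hT,
    integral_div, integral_sub (integrable_measureT (by fun_prop))
      (integrable_measureT (by fun_prop)),
    integral_eval_T_real_measureT_of_ne_zero (n := k + 2) (by omega)]
  split_ifs with h
  · rw [h, integral_eval_T_real_measureT_zero]
    have := Real.pi_ne_zero
    field_simp
    ring
  · rw [integral_eval_T_real_measureT_of_ne_zero h]
    simp

lemma eval_U_add_one (k : ℤ) (y : ℝ) :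
    (U ℝ (k + 1)).eval (y / 2) = y * (U ℝ k).eval (y / 2) - (U ℝ (k - 1)).eval (y / 2) := by
  rw [U_add_one]
  simp only [Polynomial.eval_sub, Polynomial.eval_mul, Polynomial.eval_X, Polynomial.eval_ofNat]
  ring

lemma eval_T_add_one (k : ℤ) (y : ℝ) :
    (T ℝ (k + 1)).eval (y / 2) = y * (T ℝ k).eval (y / 2) - (T ℝ (k - 1)).eval (y / 2) := by
  rw [T_add_one]
  simp only [Polynomial.eval_sub, Polynomial.eval_mul, Polynomial.eval_X, Polynomial.eval_ofNat]
  ring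

lemma integrableOn_hilbert {x ε : ℝ} (hε : 0 < ε) (k : ℤ) :
    IntegrableOn (fun y => (U ℝ k).eval (y / 2) / (x - y) * semicircle y)
      (puncturedInterval x ε) := by
  refine integrableOn_puncturedInterval hε (ContinuousOn.mul ?_ continuous_semicircle.continuousOn)
  exact ContinuousOn.div (by fun_prop) (by fun_prop) fun y hy h => hy (sub_eq_zero.mp h).symm

lemma integrableOn_differenceQuotient {x ε : ℝ} (hε : 0 < ε) (k : ℤ) :
    IntegrableOn (fun y => ((U ℝ k).eval (x / 2) - (U ℝ k).eval (y / 2)) / (x - y) ^ 2 *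
      semicircle y) (puncturedInterval x ε) := by
  refine integrableOn_puncturedInterval hε (ContinuousOn.mul ?_ continuous_semicircle.continuousOn)
  exact ContinuousOn.div (by fun_prop) (by fun_prop)
    fun y hy h => hy (sub_eq_zero.mp (pow_eq_zero_iff two_ne_zero |>.mp h)).symm

lemma tendsto_hilbert_add_one {x a b : ℝ} (k : ℤ) (hk : 0 ≤ k)
    (ha : Tendsto (fun ε => ∫ y in puncturedInterval x ε,
      (U ℝ k).eval (y / 2) / (x - y) * semicircle y) (𝓝[>] 0) (𝓝 a))
    (hb : Tendsto (fun ε => ∫ y in puncturedInterval x ε,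
      (U ℝ (k - 1)).eval (y / 2) / (x - y) * semicircle y) (𝓝[>] 0) (𝓝 b)) :
    Tendsto (fun ε => ∫ y in puncturedInterval x ε,
      (U ℝ (k + 1)).eval (y / 2) / (x - y) * semicircle y) (𝓝[>] 0)
      (𝓝 (x * a - (if k = 0 then 1 else 0) - b)) := by
  have hcont : Continuous fun y => (U ℝ k).eval (y / 2) * semicircle y :=
    Continuous.mul (by fun_prop) continuous_semicircle
  have hc := tendsto_setIntegral_puncturedInterval x
    (hcont.continuousOn.integrableOn_Icc.mono_set Ioo_subset_Icc_self)
  rw [integral_eval_U_mul_semicircle k hk] at hc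
  refine (((ha.const_mul x).sub hc).sub hb).congr' ?_
  filter_upwards [self_mem_nhdsWithin] with ε hε
  rw [mem_Ioi] at hε
  have hxa := (integrableOn_hilbert (x := x) hε k).const_mul x
  have hi : IntegrableOn (fun y => (U ℝ k).eval (y / 2) * semicircle y) (puncturedInterval x ε) :=
    integrableOn_puncturedInterval hε hcont.continuousOn
  have hxi : IntegrableOn (fun y => x * ((U ℝ k).eval (y / 2) / (x - y) * semicircle y) -
      (U ℝ k).eval (y / 2) * semicircle y) (puncturedInterval x ε) := hxa.sub hi
  rw [← integral_const_mul, ← integral_sub hxa hi, ← integral_sub hxi (integrableOn_hilbert hε _)]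
  refine setIntegral_congr_fun (measurableSet_puncturedInterval x ε) fun y hy => ?_
  have hxy : x - y ≠ 0 := fun h => by
    have := hy.2
    rw [← neg_sub, h, neg_zero, abs_zero] at this
    exact this.not_gt hε
  simp only [eval_U_add_one]
  field_simp
  ring

lemma tendsto_hilbert {x : ℝ} (hx : x ∈ Ioo (-2 : ℝ) 2) (n : ℕ) :
    Tendsto (fun ε => ∫ y in puncturedInterval x ε,
      (U ℝ n).eval (y / 2) / (x - y) * semicircle y) (𝓝[>] 0)
      (𝓝 ((T ℝ (n + 1)).eval (x / 2))) := by
  have h₀ : Tendsto (fun ε => ∫ y in puncturedInterval x ε,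
      (U ℝ 0).eval (y / 2) / (x - y) * semicircle y) (𝓝[>] 0) (𝓝 (x / 2)) := by
    simpa [div_eq_inv_mul] using tendsto_hilbert_semicircle hx
  induction n using Nat.twoStepInduction with
  | zero => simpa using h₀
  | one =>
    have h := tendsto_hilbert_add_one 0 le_rfl h₀ (b := 0) (by simp)
    rw [if_pos rfl, sub_zero] at h
    rw [Nat.cast_one, eval_T_add_one]
    simpa using h
  | more n ih₀ ih₁ =>
    have h := tendsto_hilbert_add_one (n + 1 : ℤ) (by omega) (by simpa using ih₁)
      (by simpa using ih₀)
    rw [if_neg (by omega)] at h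
    rw [sub_zero, add_assoc (n : ℤ), one_add_one_eq_two] at h
    push_cast
    rwa [eval_T_add_one, show (n : ℤ) + 2 - 1 = n + 1 by ring]

lemma tendsto_differenceQuotient_add_one {x a b c : ℝ} (k : ℤ)
    (ha : Tendsto (fun ε => ∫ y in puncturedInterval x ε,
      ((U ℝ k).eval (x / 2) - (U ℝ k).eval (y / 2)) / (x - y) ^ 2 * semicircle y)
      (𝓝[>] 0) (𝓝 a))
    (hb : Tendsto (fun ε => ∫ y in puncturedInterval x ε,
      ((U ℝ (k - 1)).eval (x / 2) - (U ℝ (k - 1)).eval (y / 2)) / (x - y) ^ 2 * semicircle y)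
      (𝓝[>] 0) (𝓝 b))
    (hc : Tendsto (fun ε => ∫ y in puncturedInterval x ε,
      (U ℝ k).eval (y / 2) / (x - y) * semicircle y) (𝓝[>] 0) (𝓝 c)) :
    Tendsto (fun ε => ∫ y in puncturedInterval x ε,
      ((U ℝ (k + 1)).eval (x / 2) - (U ℝ (k + 1)).eval (y / 2)) / (x - y) ^ 2 * semicircle y)
      (𝓝[>] 0) (𝓝 (x * a + c - b)) := by
  refine (((ha.const_mul x).add hc).sub hb).congr' ?_
  filter_upwards [self_mem_nhdsWithin] with ε hε
  rw [mem_Ioi] at hε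
  have hxa := (integrableOn_differenceQuotient (x := x) hε k).const_mul x
  have hi := integrableOn_hilbert (x := x) hε k
  have hxi : IntegrableOn (fun y =>
      x * (((U ℝ k).eval (x / 2) - (U ℝ k).eval (y / 2)) / (x - y) ^ 2 * semicircle y) +
        (U ℝ k).eval (y / 2) / (x - y) * semicircle y) (puncturedInterval x ε) := hxa.add hi
  rw [← integral_const_mul, ← integral_add hxa hi,
    ← integral_sub hxi (integrableOn_differenceQuotient hε _)]
  refine setIntegral_congr_fun (measurableSet_puncturedInterval x ε) fun y hy => ?_
  have hxy : x - y ≠ 0 := fun h => by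
    have := hy.2
    rw [← neg_sub, h, neg_zero, abs_zero] at this
    exact this.not_gt hε
  simp only [eval_U_add_one]
  field_simp
  ring

lemma tendsto_differenceQuotient {x : ℝ} (hx : x ∈ Ioo (-2 : ℝ) 2) (n : ℕ) :
    Tendsto (fun ε => ∫ y in puncturedInterval x ε,
      ((U ℝ n).eval (x / 2) - (U ℝ n).eval (y / 2)) / (x - y) ^ 2 * semicircle y)
      (𝓝[>] 0) (𝓝 (n / 2 * (U ℝ n).eval (x / 2))) := by
  induction n using Nat.twoStepInduction with
  | zero => simp
  | one =>
    have h := tendsto_differenceQuotient_add_one 0 (a := 0) (b := 0) (by simp) (by simp)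
      (tendsto_hilbert hx 0)
    convert h using 2 <;> simp
  | more n ih₀ ih₁ =>
    have h := tendsto_differenceQuotient_add_one (n + 1 : ℤ) (by simpa using ih₁)
      (by simpa using ih₀) (by simpa using tendsto_hilbert hx (n + 1))
    have hU := eval_U_add_one (n + 1) x
    have hT := congrArg (Polynomial.eval (x / 2)) (two_mul_T_eq_U_sub_U ℝ n)
    rw [Polynomial.eval_sub, Polynomial.eval_mul, Polynomial.eval_ofNat] at hT
    rw [add_assoc (n : ℤ), one_add_one_eq_two] at h hU
    rw [add_sub_cancel_right] at hU
    push_cast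
    convert h using 2
    linear_combination (-1 / 2) * hT + (n + 1) / 2 * hU

/-- **Diagonalization of `K` by Chebyshev polynomials** (equation (3.9)).  For every `n ≥ 0`
and every `x ∈ (-2,2)`, the principal value integral
`p.v. ∫_{-2}^{2} (P_n(x) - P_n(y))/(x-y)² ρ(y) dy` exists and equals `(n/2) P_n(x)`,
i.e. `K P_n = (n/2) P_n`. -/
theorem chebyshev_diagonalizes_K (n : ℕ) (x : ℝ) (hx : x ∈ Set.Ioo (-2 : ℝ) 2) :
    Filter.Tendsto
      (fun ε : ℝ =>
        ∫ y in {y : ℝ | y ∈ Set.Ioo (-2 : ℝ) 2 ∧ ε < |y - x|},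
          (chebP n x - chebP n y) / (x - y) ^ 2 * semicircle y)
      (nhdsWithin 0 (Set.Ioi 0))
      (nhds ((n / 2 : ℝ) * chebP n x)) :=
  tendsto_differenceQuotient hx n
end
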